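/- Let 0 < α < 1 be real and let F(z) = (z − α)/(1 − αz) + 2α for z on the unit circle S¹. Then ∫_{S¹} |F(z)|² dz = 1, the function |F| is non-constant on S¹, and consequently its L¹ norm is strictly less than one: ∫_{S¹} |F(z)| dz < 1. -/

import Mathlib

open Real

lemma one_sub_real_mul_ne_zero {α : ℝ} (hα0 : 0 < α) (hα1 : α < 1) {z : ℂ} (hz : ‖z‖ ≤ 1) :
    1 - (α : ℂ) * z ≠ 0 := by
  intro h
  have h1 : ‖(α : ℂ) * z‖ = 1 := by rw [← sub_eq_zero.mp h, norm_one]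
  rw [norm_mul, Complex.norm_real, Real.norm_of_nonneg hα0.le] at h1
  nlinarith

lemma norm_blaschke_add_sq {α : ℝ} (hα0 : 0 < α) (hα1 : α < 1) {z : ℂ} (hz : ‖z‖ = 1) :
    ‖(z - (α : ℂ)) / (1 - (α : ℂ) * z) + 2 * (α : ℂ)‖ ^ 2 =
      (1 + 4 * (α : ℂ) ^ 2 + 4 * α * ((z - (α : ℂ)) / (1 - (α : ℂ) * z))).re := by
  have hB : Complex.normSq ((z - (α : ℂ)) / (1 - (α : ℂ) * z)) = 1 := by
    have hne := one_sub_real_mul_ne_zero hα0 hα1 hz.le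
    rw [Complex.normSq_div, div_eq_one_iff_eq (by simpa using hne)]
    have h := Complex.normSq_eq_norm_sq z
    rw [hz, Complex.normSq_apply] at h
    simp [Complex.normSq_apply]
    linear_combination (1 - α ^ 2) * h
  generalize (z - (α : ℂ)) / (1 - (α : ℂ) * z) = b at hB ⊢
  rw [← Complex.normSq_eq_norm_sq]
  rw [Complex.normSq_apply] at hB ⊢
  simp [pow_two]
  linear_combination hB

lemma circleAverage_norm_blaschke_add_sq {α : ℝ} (hα0 : 0 < α) (hα1 : α < 1) :
    circleAverage (fun z : ℂ ↦ ‖(z - (α : ℂ)) / (1 - (α : ℂ) * z) + 2 * (α : ℂ)‖ ^ 2) 0 1 = 1 := by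
  set G : ℂ → ℂ := fun z ↦ 1 + 4 * (α : ℂ) ^ 2 + 4 * α * ((z - (α : ℂ)) / (1 - (α : ℂ) * z))
    with hG
  have hd : DifferentiableOn ℂ G (Metric.closedBall 0 1) := by
    intro z hz
    have hne := one_sub_real_mul_ne_zero hα0 hα1 (mem_closedBall_zero_iff.mp hz)
    apply DifferentiableAt.differentiableWithinAt
    simp only [hG]
    fun_prop (disch := exact hne)
  have hc : DiffContOnCl ℂ G (Metric.ball 0 |1|) := by
    apply DifferentiableOn.diffContOnCl
    rwa [abs_one, closure_ball (0 : ℂ) one_ne_zero]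
  have hint : CircleIntegrable G 0 1 :=
    (hd.continuousOn.mono Metric.sphere_subset_closedBall).circleIntegrable zero_le_one
  have h := Complex.reCLM.circleAverage_comp_comm hint
  rw [hc.circleAverage] at h
  rw [circleAverage_congr_sphere (f₂ := Complex.reCLM ∘ G), h]
  · simp [hG, pow_two]
    ring
  · intro z hz
    rw [abs_one, mem_sphere_zero_iff_norm] at hz
    exact norm_blaschke_add_sq hα0 hα1 hz

/-- Let `0 < α < 1` and `F(z) = (z − α)/(1 − αz) + 2α` on the unit circle.
Then `∫_{S¹} |F(z)|² dz = 1`, the function `|F|` is non-constant on `S¹`, and consequently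
its `L¹` norm is strictly less than one: `∫_{S¹} |F(z)| dz < 1`. -/
theorem shifted_blaschke_L1_lt_one
    (α : ℝ) (hα0 : 0 < α) (hα1 : α < 1)
    (F : ℂ → ℂ) (hF : ∀ z, F z = (z - (α : ℂ)) / (1 - (α : ℂ) * z) + 2 * (α : ℂ)) :
    ((2 * π)⁻¹ * ∫ θ in (0 : ℝ)..(2 * π), ‖F (Complex.exp (θ * Complex.I))‖ ^ 2 = 1) ∧
    (∃ z ∈ Metric.sphere (0 : ℂ) 1, ∃ w ∈ Metric.sphere (0 : ℂ) 1, ‖F z‖ ≠ ‖F w‖) ∧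
    ((2 * π)⁻¹ * ∫ θ in (0 : ℝ)..(2 * π), ‖F (Complex.exp (θ * Complex.I))‖ < 1) := by
  have hL2 : (2 * π)⁻¹ * ∫ θ in (0 : ℝ)..(2 * π), ‖F (Complex.exp (θ * Complex.I))‖ ^ 2 = 1 := by
    have h := circleAverage_norm_blaschke_add_sq hα0 hα1
    simp only [← hF] at h
    simpa [circleAverage_def, circleMap] using h
  have hF1 : F 1 = ((1 + 2 * α : ℝ) : ℂ) := by
    have hne : (1 : ℂ) - α ≠ 0 := by exact_mod_cast (sub_pos.mpr hα1).ne'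
    rw [hF, mul_one, div_self hne]
    push_cast
    ring
  have hFneg : F (-1) = ((2 * α - 1 : ℝ) : ℂ) := by
    have hne : (1 : ℂ) + α ≠ 0 := by exact_mod_cast (by positivity : 1 + α ≠ 0)
    rw [hF, show (-1 : ℂ) - α = -(1 + α) by ring, show (1 : ℂ) - α * -1 = 1 + α by ring,
      neg_div, div_self hne]
    push_cast
    ring
  have hn1 : ‖F 1‖ = 1 + 2 * α := by
    rw [hF1, Complex.norm_real, Real.norm_of_nonneg (by positivity)]
  refine ⟨hL2, ⟨1, by simp, -1, by simp, ?_⟩, ?_⟩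
  · rw [hn1, hFneg, Complex.norm_real, Real.norm_eq_abs]
    exact (abs_lt.mpr ⟨by linarith, by linarith⟩).ne'
  · have hcont : Continuous fun θ : ℝ ↦ ‖F (Complex.exp (θ * Complex.I))‖ := by
      simp only [hF]
      refine ((Continuous.div (by fun_prop) (by fun_prop) fun θ ↦ ?_).add continuous_const).norm
      exact one_sub_real_mul_ne_zero hα0 hα1 (Complex.norm_exp_ofReal_mul_I θ).le
    have hpos : 0 < ∫ θ in (0 : ℝ)..(2 * π), (1 - ‖F (Complex.exp (θ * Complex.I))‖) ^ 2 := by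
      refine intervalIntegral.integral_pos two_pi_pos
        ((continuous_const.sub hcont).pow 2).continuousOn (fun _ _ ↦ sq_nonneg _)
        ⟨0, ⟨le_rfl, two_pi_pos.le⟩, ?_⟩
      simp only [Complex.ofReal_zero, zero_mul, Complex.exp_zero, hn1]
      nlinarith [mul_pos hα0 hα0]
    have hexp : ∫ θ in (0 : ℝ)..(2 * π), (1 - ‖F (Complex.exp (θ * Complex.I))‖) ^ 2 =
        2 * π - 2 * (∫ θ in (0 : ℝ)..(2 * π), ‖F (Complex.exp (θ * Complex.I))‖) +
          ∫ θ in (0 : ℝ)..(2 * π), ‖F (Complex.exp (θ * Complex.I))‖ ^ 2 := by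
      have hi := hcont.intervalIntegrable (μ := MeasureTheory.volume) 0 (2 * π)
      have hi2 : IntervalIntegrable (fun θ : ℝ ↦ ‖F (Complex.exp (θ * Complex.I))‖ ^ 2)
          MeasureTheory.volume 0 (2 * π) := (hcont.pow 2).intervalIntegrable 0 (2 * π)
      simp only [sub_sq, one_pow, mul_one]
      rw [intervalIntegral.integral_add (intervalIntegrable_const.sub (hi.const_mul 2)) hi2,
        intervalIntegral.integral_sub intervalIntegrable_const (hi.const_mul 2),
        intervalIntegral.integral_const_mul]
      simp
    rw [inv_mul_eq_iff_eq_mul₀ two_pi_pos.ne', mul_one] at hL2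
    rw [inv_mul_lt_iff₀ two_pi_pos]
    linarith
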